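/- Let n be a nonnegative integer and μ ∈ ℂ with 2μ + t ≠ 0 for every integer t with 0 ≤ t ≤ 2n. Then Σ_{ℓ=0}^{n} (−1)^ℓ · binom(n,ℓ) · ((2μ+2ℓ)/(2μ+ℓ)_{n+1}) = δ_{n,0}, i.e. the sum equals 1 if n = 0 and equals 0 if n ≥ 1. -/

import Mathlib

open scoped BigOperators

noncomputable section

/-- Ascending Pochhammer symbol `(a)_n = a (a+1) ⋯ (a+n-1)`. -/
def aP (n : ℕ) (a : ℂ) : ℂ := (ascPochhammer ℂ n).eval a

theorem aP_succ_right (n : ℕ) (a : ℂ) : aP (n + 1) a = aP n a * (a + n) := by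
  simp [aP, ascPochhammer_succ_eval]

theorem aP_succ_left (n : ℕ) (a : ℂ) : aP (n + 1) a = a * aP n (a + 1) := by
  simp [aP, ascPochhammer_succ_left]

theorem aP_ne_zero (n : ℕ) (a : ℂ) (h : ∀ t < n, a + (t : ℂ) ≠ 0) : aP n a ≠ 0 := by
  induction n with
  | zero => simp [aP]
  | succ n ih =>
    rw [aP_succ_right]
    exact mul_ne_zero (ih fun t ht => h t (by omega)) (h n (by omega))

/-- Closed form of the partial sums of the alternating Pochhammer sum. -/
theorem sum_range_alternating_pochhammer (m : ℕ) (a : ℂ)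
    (ha : ∀ t : ℕ, t ≤ 2 * (m + 1) → a + (t : ℂ) ≠ 0) (k : ℕ) (hk : k ≤ m + 1) :
    ∑ ℓ ∈ Finset.range (k + 1),
        (-1) ^ ℓ * ((m + 1).choose ℓ : ℂ) * ((a + 2 * ℓ) / aP (m + 2) (a + ℓ)) =
      (-1) ^ k * (m.choose k : ℂ) / aP (m + 1) (a + k + 1) := by
  induction k with
  | zero =>
    have h0 : a ≠ 0 := by simpa using ha 0 (by omega)
    simp only [zero_add, Finset.sum_range_one, aP_succ_left (m + 1)]
    simp [div_mul_cancel_left₀ h0]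
  | succ k ih =>
    rw [Finset.sum_range_succ, ih (by omega)]
    have hb : a + k + 1 ≠ 0 := by
      simpa [add_assoc] using ha (k + 1) (by omega)
    have hP : aP (m + 1) (a + k + 1) ≠ 0 := aP_ne_zero _ _ fun t ht => by
      simpa [add_assoc] using ha (k + 1 + t) (by omega)
    have hQ : aP (m + 1) (a + k + 1 + 1) ≠ 0 := aP_ne_zero _ _ fun t ht => by
      have := ha (k + 1 + 1 + t) (by omega)
      push_cast at this
      simpa only [add_assoc] using this
    have hPQ : aP (m + 1) (a + k + 1) * (a + k + 1 + (m + 1)) =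
        (a + k + 1) * aP (m + 1) (a + k + 1 + 1) := by
      have := aP_succ_left (m + 1) (a + k + 1)
      rw [aP_succ_right] at this
      exact_mod_cast this
    have hpascal : ((m + 1).choose (k + 1) : ℂ) = m.choose k + m.choose (k + 1) := by
      exact_mod_cast Nat.choose_succ_succ m k
    have habsorb : ((m : ℂ) + 1) * m.choose k = (m + 1).choose (k + 1) * (k + 1) := by
      exact_mod_cast Nat.add_one_mul_choose_eq m k
    push_cast
    rw [← add_assoc a, aP_succ_left (m + 1)]
    rw [hpascal] at habsorb ⊢
    generalize aP (m + 1) (a + k + 1) = P at *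
    generalize aP (m + 1) (a + k + 1 + 1) = Q at *
    field_simp
    rw [pow_succ]
    linear_combination (-1) ^ k * (-(m.choose k : ℂ) * hPQ + P * habsorb)

/-- A combinatorial identity: the alternating Pochhammer sum equals the Kronecker delta `δ_{n,0}`. -/
theorem alternating_pochhammer_sum (n : ℕ) (μ : ℂ)
    (hμ : ∀ t : ℕ, t ≤ 2 * n → 2 * μ + (t : ℂ) ≠ 0) :
    ∑ ℓ ∈ Finset.range (n + 1),
        (-1) ^ ℓ * (n.choose ℓ : ℂ) * ((2 * μ + 2 * ℓ) / aP (n + 1) (2 * μ + ℓ)) =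
      if n = 0 then 1 else 0 := by
  cases n with
  | zero =>
    have h0 : 2 * μ ≠ 0 := by simpa using hμ 0 le_rfl
    simp only [zero_add, Finset.sum_range_one, aP_succ_left 0]
    simpa [aP] using h0
  | succ m =>
    rw [sum_range_alternating_pochhammer m (2 * μ) hμ (m + 1) le_rfl]
    simp
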